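/- The natural transformations ε̲ : τ⁻τ → Id_{C̲_r} and η̄ : Id_{C̄_l} → ττ⁻ are isomorphisms. Consequently the generalized Auslander–Reiten translation functors τ : C̲_r → C̄_l and τ⁻ : C̄_l → C̲_r are mutually quasi-inverse equivalences of categories. -/

import Mathlib

/-!
Common setup: a Hom-finite Krull-Schmidt `k`-linear abelian category `C`, regarded as an exact
category whose conflations are all short exact sequences.  The Yoneda Ext¹-bifunctor of this
exact structure, together with the assignment of its extension class to each short exact
sequence and the standard pullback/pushout functorialities, is axiomatized by the structure
`YonedaExt` below.  (Over a field, Hom-finiteness together with the existence of an abelian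
structure makes `C` Krull-Schmidt automatically.)
-/

open CategoryTheory CategoryTheory.Limits

universe v u

namespace GenAR

/-- An axiomatization of the Yoneda `Ext¹`-bifunctor of a `k`-linear abelian category `C`
(with the exact structure given by all short exact sequences):  `ext X Y` is the `k`-module
of equivalence classes of conflations `Y → E → X`; `pull f Y` is `Ext(f,Y)` (pullback, i.e.
`μ ↦ μ.f`); `push X g` is `Ext(X,g)` (pushout, i.e. `μ ↦ g.μ`); `cls` assigns to a short
exact sequence its class, which vanishes iff the sequence splits; every class is realized by
a conflation, and pullback/pushout classes are realized by actual pullback/pushout diagrams. -/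
structure YonedaExt (k : Type) [Field k] (C : Type u) [Category.{v} C] [Abelian C]
    [Linear k C] where
  ext : C → C → ModuleCat.{v} k
  pull : ∀ {X' X : C} (_ : X' ⟶ X) (Y : C), ext X Y →ₗ[k] ext X' Y
  push : ∀ (X : C) {Y Y' : C} (_ : Y ⟶ Y'), ext X Y →ₗ[k] ext X Y'
  pull_id : ∀ X Y : C, pull (𝟙 X) Y = LinearMap.id
  pull_comp : ∀ {X'' X' X : C} (f : X'' ⟶ X') (g : X' ⟶ X) (Y : C),
    pull (f ≫ g) Y = (pull f Y).comp (pull g Y)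
  pull_zero : ∀ (X' X Y : C), pull (0 : X' ⟶ X) Y = 0
  pull_add : ∀ {X' X : C} (f g : X' ⟶ X) (Y : C), pull (f + g) Y = pull f Y + pull g Y
  pull_smul : ∀ {X' X : C} (a : k) (f : X' ⟶ X) (Y : C), pull (a • f) Y = a • pull f Y
  push_id : ∀ X Y : C, push X (𝟙 Y) = LinearMap.id
  push_comp : ∀ (X : C) {Y Y' Y'' : C} (g : Y ⟶ Y') (g' : Y' ⟶ Y''),
    push X (g ≫ g') = (push X g').comp (push X g)
  push_zero : ∀ (X Y Y' : C), push X (0 : Y ⟶ Y') = 0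
  push_add : ∀ (X : C) {Y Y' : C} (g h : Y ⟶ Y'), push X (g + h) = push X g + push X h
  push_smul : ∀ (X : C) {Y Y' : C} (a : k) (g : Y ⟶ Y'), push X (a • g) = a • push X g
  pull_push : ∀ {X' X Y Y' : C} (f : X' ⟶ X) (g : Y ⟶ Y'),
    (push X' g).comp (pull f Y) = (pull f Y').comp (push X g)
  cls : ∀ {S : ShortComplex C}, S.ShortExact → ext S.X₃ S.X₁
  cls_eq_zero_iff : ∀ {S : ShortComplex C} (hS : S.ShortExact),
    cls hS = 0 ↔ Nonempty S.Splitting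
  cls_surjective : ∀ (X Y : C) (e : ext X Y), ∃ (E : C) (i : Y ⟶ E) (p : E ⟶ X)
    (w : i ≫ p = 0) (hS : (ShortComplex.mk i p w).ShortExact), cls hS = e
  cls_pull : ∀ {S : ShortComplex C} (hS : S.ShortExact) {Z : C} (f : Z ⟶ S.X₃),
    ∃ (E' : C) (i' : S.X₁ ⟶ E') (p' : E' ⟶ Z) (w' : i' ≫ p' = 0)
      (hS' : (ShortComplex.mk i' p' w').ShortExact) (m : E' ⟶ S.X₂),
      cls hS' = pull f S.X₁ (cls hS) ∧ i' ≫ m = S.f ∧ m ≫ S.g = p' ≫ f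
  cls_push : ∀ {S : ShortComplex C} (hS : S.ShortExact) {Z : C} (g : S.X₁ ⟶ Z),
    ∃ (E' : C) (i' : Z ⟶ E') (p' : E' ⟶ S.X₃) (w' : i' ≫ p' = 0)
      (hS' : (ShortComplex.mk i' p' w').ShortExact) (m : S.X₂ ⟶ E'),
      cls hS' = push S.X₃ g (cls hS) ∧ S.f ≫ m = g ≫ i' ∧ m ≫ p' = S.g

variable {k : Type} [Field k] {C : Type u} [Category.{v} C] [Abelian C] [Linear k C]

/-- The ideal of injectively trivial morphisms `M ⟶ X`, i.e. those `f` with `Ext(Z,f) = 0`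
for every `Z`. -/
def ITriv (T : YonedaExt k C) (M X : C) : Submodule k (M ⟶ X) where
  carrier := {f | ∀ Z : C, T.push Z f = 0}
  add_mem' := by
    intro f g hf hg Z
    rw [T.push_add, hf Z, hg Z, add_zero]
  zero_mem' := fun Z => T.push_zero Z _ _
  smul_mem' := by
    intro a f hf Z
    rw [T.push_smul, hf Z, smul_zero]

lemma mem_ITriv {T : YonedaExt k C} {M X : C} {f : M ⟶ X} :
    f ∈ ITriv T M X ↔ ∀ Z : C, T.push Z f = 0 := Iff.rfl

/-- The ideal of projectively trivial morphisms `M ⟶ X`, i.e. those `f` with `Ext(f,Z) = 0`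
for every `Z`. -/
def PTriv (T : YonedaExt k C) (M X : C) : Submodule k (M ⟶ X) where
  carrier := {f | ∀ Z : C, T.pull f Z = 0}
  add_mem' := by
    intro f g hf hg Z
    rw [T.pull_add, hf Z, hg Z, add_zero]
  zero_mem' := fun Z => T.pull_zero _ _ Z
  smul_mem' := by
    intro a f hf Z
    rw [T.pull_smul, hf Z, smul_zero]

lemma mem_PTriv {T : YonedaExt k C} {M X : C} {f : M ⟶ X} :
    f ∈ PTriv T M X ↔ ∀ Z : C, T.pull f Z = 0 := Iff.rfl

/-- Hom-spaces of the injectively stable category `C̄ = C/I`. -/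
abbrev HomBar (T : YonedaExt k C) (M X : C) := (M ⟶ X) ⧸ ITriv T M X

/-- Hom-spaces of the projectively stable category `C̲ = C/P`. -/
abbrev HomUnder (T : YonedaExt k C) (M X : C) := (M ⟶ X) ⧸ PTriv T M X

/-- `u : X ⟶ E` is left almost split: it is not a section, and every non-section
`X ⟶ Z` factors through it. -/
def IsLeftAlmostSplit {X E : C} (u : X ⟶ E) : Prop :=
  (¬ ∃ r : E ⟶ X, u ≫ r = 𝟙 X) ∧
  ∀ (Z : C) (f : X ⟶ Z), (¬ ∃ r : Z ⟶ X, f ≫ r = 𝟙 X) → ∃ h : E ⟶ Z, u ≫ h = f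

/-- `v : E ⟶ Y` is right almost split: it is not a retraction, and every non-retraction
`Z ⟶ Y` factors through it. -/
def IsRightAlmostSplit {E Y : C} (v : E ⟶ Y) : Prop :=
  (¬ ∃ s : Y ⟶ E, s ≫ v = 𝟙 Y) ∧
  ∀ (Z : C) (f : Z ⟶ Y), (¬ ∃ s : Y ⟶ Z, s ≫ f = 𝟙 Y) → ∃ h : Z ⟶ E, h ≫ v = f

/-- `X → E → Y` is an almost split conflation. -/
def IsAlmostSplitConflation {X E Y : C} (u : X ⟶ E) (v : E ⟶ Y) (w : u ≫ v = 0) : Prop :=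
  (ShortComplex.mk u v w).ShortExact ∧ IsLeftAlmostSplit u ∧ IsRightAlmostSplit v

/-- `Z` is a direct summand of `Y`. -/
def IsDirectSummand (Z Y : C) : Prop := ∃ (i : Z ⟶ Y) (r : Y ⟶ Z), i ≫ r = 𝟙 Z

/-- An indecomposable object. -/
def Indec (Y : C) : Prop :=
  ¬ IsZero Y ∧ ∀ A B : C, Nonempty (Y ≅ A ⊞ B) → IsZero A ∨ IsZero B

/-- Injective object of the exact category: every conflation starting at it splits,
equivalently `Ext(-,X)` vanishes. -/
def IsInjObj (T : YonedaExt k C) (X : C) : Prop := ∀ (Z : C) (e : T.ext Z X), e = 0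

/-- Projective object of the exact category: every conflation ending at it splits,
equivalently `Ext(X,-)` vanishes. -/
def IsProjObj (T : YonedaExt k C) (X : C) : Prop := ∀ (Z : C) (e : T.ext X Z), e = 0

/-- `Yt` represents the functor `D Ext(Y,-) : C̄ → k-Mod`, i.e. there is an isomorphism of
functors `Hom̄(-,Yt) ≅ D Ext(Y,-)`. -/
def RepresentsR (T : YonedaExt k C) (Y Yt : C) : Prop :=
  ∃ e : ∀ M : C, HomBar T M Yt ≃ₗ[k] Module.Dual k (T.ext Y M),
    ∀ (M M' : C) (h : M ⟶ M') (f : M' ⟶ Yt) (μ : T.ext Y M),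
      e M (Submodule.Quotient.mk (h ≫ f)) μ = e M' (Submodule.Quotient.mk f) (T.push Y h μ)

/-- `Xt` represents the functor `D Ext(-,X) : C̲ → k-Mod`, i.e. there is an isomorphism of
functors `Hom̲(Xt,-) ≅ D Ext(-,X)`. -/
def RepresentsL (T : YonedaExt k C) (X Xt : C) : Prop :=
  ∃ e : ∀ M : C, HomUnder T Xt M ≃ₗ[k] Module.Dual k (T.ext M X),
    ∀ (M M' : C) (h : M ⟶ M') (g : Xt ⟶ M) (μ : T.ext M' X),
      e M' (Submodule.Quotient.mk (g ≫ h)) μ = e M (Submodule.Quotient.mk g) (T.pull h X μ)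

/-- The full subcategory `C_r`: the functor `D Ext(X,-) : C̄ → k-Mod` is representable. -/
def MemCr (T : YonedaExt k C) (X : C) : Prop := ∃ Xt : C, RepresentsR T X Xt

/-- The full subcategory `C_l`: the functor `D Ext(-,X) : C̲ → k-Mod` is representable. -/
def MemCl (T : YonedaExt k C) (X : C) : Prop := ∃ Xt : C, RepresentsL T X Xt

/-- `X ≅ Y` in the projectively stable category `C̲`. -/
def StablyIsoP (T : YonedaExt k C) (X Y : C) : Prop :=
  ∃ (f : X ⟶ Y) (g : Y ⟶ X), f ≫ g - 𝟙 X ∈ PTriv T X X ∧ g ≫ f - 𝟙 Y ∈ PTriv T Y Y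

/-- `X ≅ Y` in the injectively stable category `C̄`. -/
def StablyIsoI (T : YonedaExt k C) (X Y : C) : Prop :=
  ∃ (f : X ⟶ Y) (g : Y ⟶ X), f ≫ g - 𝟙 X ∈ ITriv T X X ∧ g ≫ f - 𝟙 Y ∈ ITriv T Y Y

end GenAR
namespace GenAR

variable {k : Type} [Field k] {C : Type u} [Category.{v} C] [Abelian C] [Linear k C]

/-- The data of the generalized Auslander-Reiten translations: for each `Y ∈ C_r` a fixed
object `τY` together with a fixed natural isomorphism `φ_Y : Hom̄(-,τY) ≅ D Ext(Y,-)`, and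
for each `X ∈ C_l` a fixed object `τ⁻X` together with a fixed natural isomorphism
`ψ_X : Hom̲(τ⁻X,-) ≅ D Ext(-,X)`. -/
structure TranslationData (T : YonedaExt k C) where
  tau : ∀ Y : C, MemCr T Y → C
  phi : ∀ (Y : C) (hY : MemCr T Y) (M : C),
    HomBar T M (tau Y hY) ≃ₗ[k] Module.Dual k (T.ext Y M)
  phi_natural : ∀ (Y : C) (hY : MemCr T Y) (M M' : C) (h : M ⟶ M')
    (f : M' ⟶ tau Y hY) (μ : T.ext Y M),
    phi Y hY M (Submodule.Quotient.mk (h ≫ f)) μ =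
      phi Y hY M' (Submodule.Quotient.mk f) (T.push Y h μ)
  taum : ∀ X : C, MemCl T X → C
  psi : ∀ (X : C) (hX : MemCl T X) (M : C),
    HomUnder T (taum X hX) M ≃ₗ[k] Module.Dual k (T.ext M X)
  psi_natural : ∀ (X : C) (hX : MemCl T X) (M M' : C) (h : M ⟶ M')
    (g : taum X hX ⟶ M) (μ : T.ext M' X),
    psi X hX M' (Submodule.Quotient.mk (g ≫ h)) μ =
      psi X hX M (Submodule.Quotient.mk g) (T.pull h X μ)

variable {T : YonedaExt k C}

/-- `t : τY ⟶ τY'` represents the morphism `τ(f̲) : τY → τY'` in `C̄`, i.e. the unique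
morphism with `φ_{Y'} ∘ Hom̄(-,τ(f̲)) = D Ext(f,-) ∘ φ_Y`. -/
def IsTauMap (D : TranslationData T) {Y Y' : C} (hY : MemCr T Y) (hY' : MemCr T Y')
    (f : Y ⟶ Y') (t : D.tau Y hY ⟶ D.tau Y' hY') : Prop :=
  ∀ (M : C) (g : M ⟶ D.tau Y hY) (μ : T.ext Y' M),
    D.phi Y' hY' M (Submodule.Quotient.mk (g ≫ t)) μ =
      D.phi Y hY M (Submodule.Quotient.mk g) (T.pull f M μ)

/-- `s : τ⁻X ⟶ τ⁻X'` represents the morphism `τ⁻(ḡ) : τ⁻X → τ⁻X'` in `C̲`, i.e. the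
unique morphism with `ψ_X ∘ Hom̲(τ⁻(ḡ),-) = D Ext(-,g) ∘ ψ_{X'}`. -/
def IsTauMinusMap (D : TranslationData T) {X X' : C} (hX : MemCl T X) (hX' : MemCl T X')
    (g : X ⟶ X') (s : D.taum X hX ⟶ D.taum X' hX') : Prop :=
  ∀ (M : C) (h : D.taum X' hX' ⟶ M) (μ : T.ext M X),
    D.psi X hX M (Submodule.Quotient.mk (s ≫ h)) μ =
      D.psi X' hX' M (Submodule.Quotient.mk h) (T.push M g μ)

/-- The morphism `ε̲_Y = (ψ_{τY,Y})⁻¹(φ_{Y,τY}(Id̄_{τY})) : τ⁻τY → Y` in `C̲`. -/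
def epsClass (D : TranslationData T) (Y : C) (hY : MemCr T Y)
    (hτY : MemCl T (D.tau Y hY)) : HomUnder T (D.taum (D.tau Y hY) hτY) Y :=
  (D.psi (D.tau Y hY) hτY Y).symm
    (D.phi Y hY (D.tau Y hY) (Submodule.Quotient.mk (𝟙 (D.tau Y hY))))

/-- The morphism `η̄_X = (φ_{τ⁻X,X})⁻¹(ψ_{X,τ⁻X}(Id̲_{τ⁻X})) : X → ττ⁻X` in `C̄`. -/
def etaClass (D : TranslationData T) (X : C) (hX : MemCl T X)
    (hτX : MemCr T (D.taum X hX)) : HomBar T X (D.tau (D.taum X hX) hτX) :=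
  (D.phi (D.taum X hX) hτX X).symm
    (D.psi X hX (D.taum X hX) (Submodule.Quotient.mk (𝟙 (D.taum X hX))))

end GenAR
namespace GenAR

variable {k : Type} [Field k] {C : Type u} [Category.{v} C] [Abelian C] [Linear k C]

namespace YonedaExt

variable (T : YonedaExt k C)

lemma pull_add_apply {X' X : C} (f g : X' ⟶ X) {Y : C} (μ : T.ext X Y) :
    T.pull (f + g) Y μ = T.pull f Y μ + T.pull g Y μ := by
  rw [T.pull_add]; rfl

lemma push_add_apply {X Y Y' : C} (f g : Y ⟶ Y') (μ : T.ext X Y) :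
    T.push X (f + g) μ = T.push X f μ + T.push X g μ := by
  rw [T.push_add]; rfl

lemma pull_sub_apply {X' X : C} (f g : X' ⟶ X) {Y : C} (μ : T.ext X Y) :
    T.pull (f - g) Y μ = T.pull f Y μ - T.pull g Y μ := by
  rw [eq_sub_iff_add_eq, ← pull_add_apply, sub_add_cancel]

lemma push_sub_apply {X Y Y' : C} (f g : Y ⟶ Y') (μ : T.ext X Y) :
    T.push X (f - g) μ = T.push X f μ - T.push X g μ := by
  rw [eq_sub_iff_add_eq, ← push_add_apply, sub_add_cancel]

lemma pull_comp_apply {X'' X' X : C} (f : X'' ⟶ X') (g : X' ⟶ X) {Y : C} (μ : T.ext X Y) :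
    T.pull (f ≫ g) Y μ = T.pull f Y (T.pull g Y μ) := by
  rw [T.pull_comp]; rfl

lemma push_comp_apply {X Y Y' Y'' : C} (f : Y ⟶ Y') (g : Y' ⟶ Y'') (μ : T.ext X Y) :
    T.push X (f ≫ g) μ = T.push X g (T.push X f μ) := by
  rw [T.push_comp]; rfl

lemma pull_id_apply {X Y : C} (μ : T.ext X Y) : T.pull (𝟙 X) Y μ = μ := by
  rw [T.pull_id]; rfl

lemma push_id_apply {X Y : C} (μ : T.ext X Y) : T.push X (𝟙 Y) μ = μ := by
  rw [T.push_id]; rfl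

lemma pull_zero_apply {X' X Y : C} (μ : T.ext X Y) : T.pull (0 : X' ⟶ X) Y μ = 0 := by
  rw [T.pull_zero]; rfl

lemma push_zero_apply {X Y Y' : C} (μ : T.ext X Y) : T.push X (0 : Y ⟶ Y') μ = 0 := by
  rw [T.push_zero]; rfl

lemma pull_smul_apply {X' X : C} (a : k) (f : X' ⟶ X) {Y : C} (μ : T.ext X Y) :
    T.pull (a • f) Y μ = a • T.pull f Y μ := by
  rw [T.pull_smul]; rfl

lemma push_smul_apply {X Y Y' : C} (a : k) (f : Y ⟶ Y') (μ : T.ext X Y) :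
    T.push X (a • f) μ = a • T.push X f μ := by
  rw [T.push_smul]; rfl

lemma push_pull_apply {X' X Y Y' : C} (f : X' ⟶ X) (g : Y ⟶ Y') (μ : T.ext X Y) :
    T.push X' g (T.pull f Y μ) = T.pull f Y' (T.push X g μ) :=
  LinearMap.congr_fun (T.pull_push f g) μ

/-- Pushing a conflation out along its own inflation gives the zero class. -/
lemma push_f_cls {S : ShortComplex C} (hS : S.ShortExact) :
    T.push S.X₃ S.f (T.cls hS) = 0 := by
  obtain ⟨E', i', p', w', hS', m, hc, h₁, h₂⟩ := T.cls_push hS S.f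
  rw [← hc, T.cls_eq_zero_iff]
  have : Epi S.g := hS.epi_g
  have hz : S.f ≫ (m - i') = 0 := by rw [Preadditive.comp_sub, h₁, sub_self]
  refine ⟨ShortComplex.Splitting.ofExactOfSection _ hS'.exact
    (hS.exact.desc (m - i') hz) ?_ hS'.mono_f⟩
  rw [← cancel_epi S.g, hS.exact.g_desc_assoc]
  simp [Preadditive.sub_comp, h₂, w']

/-- Pulling a conflation back along its own deflation gives the zero class. -/
lemma pull_g_cls {S : ShortComplex C} (hS : S.ShortExact) :
    T.pull S.g S.X₁ (T.cls hS) = 0 := by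
  obtain ⟨E', i', p', w', hS', m, hc, h₁, h₂⟩ := T.cls_pull hS S.g
  rw [← hc, T.cls_eq_zero_iff]
  have : Mono S.f := hS.mono_f
  have hz : (m - p') ≫ S.g = 0 := by rw [Preadditive.sub_comp, h₂, sub_self]
  refine ⟨ShortComplex.Splitting.ofExactOfRetraction _ hS'.exact
    (hS.exact.lift (m - p') hz) ?_ hS'.epi_g⟩
  rw [← cancel_mono S.f, Category.assoc, hS.exact.lift_f]
  simp [Preadditive.comp_sub, h₁, w']

/-- If the pushout of a conflation along `u` has zero class, then `u` extends along its
inflation. -/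
lemma exists_extension {S : ShortComplex C} (hS : S.ShortExact) {Z : C} (u : S.X₁ ⟶ Z)
    (h : T.push S.X₃ u (T.cls hS) = 0) : ∃ n : S.X₂ ⟶ Z, S.f ≫ n = u := by
  obtain ⟨E', i', p', w', hS', m, hc, h₁, -⟩ := T.cls_push hS u
  rw [← hc, T.cls_eq_zero_iff] at h
  obtain ⟨s⟩ := h
  have hr : i' ≫ s.r = 𝟙 Z := s.f_r
  exact ⟨m ≫ s.r, by rw [reassoc_of% h₁, hr, Category.comp_id]⟩

/-- If the pullback of a conflation along `u` has zero class, then `u` lifts along its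
deflation. -/
lemma exists_lift {S : ShortComplex C} (hS : S.ShortExact) {Z : C} (u : Z ⟶ S.X₃)
    (h : T.pull u S.X₁ (T.cls hS) = 0) : ∃ n : Z ⟶ S.X₂, n ≫ S.g = u := by
  obtain ⟨E', i', p', w', hS', m, hc, -, h₂⟩ := T.cls_pull hS u
  rw [← hc, T.cls_eq_zero_iff] at h
  obtain ⟨s⟩ := h
  have hr : s.s ≫ p' = 𝟙 Z := s.s_g
  exact ⟨s.s ≫ m, by rw [Category.assoc, h₂, reassoc_of% hr]⟩

/-- Let `μ ∈ Ext(M,X)` and suppose `Ext(Y,X)` is finite-dimensional.  Then `μ` has a conflation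
`X → E → M` such that every class in the kernel of `Ext(Y,X) → Ext(Y,E)` is a pullback
of `μ`.  (As `cls` is not assumed to be invariant under equivalence, the conflation has to be
chosen compatibly with conflations realizing a basis of `Ext(Y,X)`.) -/
lemma exists_inflation_of_class {M X : C} (Y : C) [FiniteDimensional k (T.ext Y X)]
    (μ : T.ext M X) : ∃ (E : C) (i : X ⟶ E), T.push M i μ = 0 ∧
      ∀ ν : T.ext Y X, T.push Y i ν = 0 → ∃ g : Y ⟶ M, T.pull g X μ = ν := by
  have : HasFiniteBiproducts C := HasFiniteBiproducts.of_hasFiniteProducts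
  let b := Module.finBasis k (T.ext Y X)
  let N := M ⊞ ⨁ fun _ : Fin (Module.finrank k (T.ext Y X)) => Y
  let e : T.ext N X := T.pull biprod.fst X μ +
    ∑ l, T.pull (biprod.snd ≫ biproduct.π _ l) X (b l)
  have he : T.pull biprod.inl X e = μ := by
    simp only [e, map_add, map_sum, ← pull_comp_apply, biprod.inl_fst, biprod.inl_snd_assoc,
      zero_comp, pull_zero_apply, pull_id_apply, Finset.sum_const_zero, add_zero]
  have hc (ν : T.ext Y X) : ∃ c : Y ⟶ N, T.pull c X e = ν := by
    refine ⟨biproduct.lift (fun l => b.repr ν l • 𝟙 Y) ≫ biprod.inr, ?_⟩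
    simp only [e, map_add, map_sum, ← pull_comp_apply, Category.assoc, biprod.inr_fst,
      biprod.inr_snd_assoc, comp_zero, pull_zero_apply, zero_add, biproduct.lift_π,
      pull_smul_apply, pull_id_apply]
    exact b.sum_repr ν
  obtain ⟨W, j, q, w, hS, hSe⟩ := T.cls_surjective N X e
  obtain ⟨E, i, p, w₁, hS₁, m, hc₁, him, hmq⟩ := T.cls_pull hS biprod.inl
  rw [hSe, he] at hc₁
  dsimp only at i p w₁ hS₁ m hc₁ him hmq
  refine ⟨E, i, by rw [← hc₁]; exact T.push_f_cls hS₁, fun ν hν => ?_⟩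
  obtain ⟨c, rfl⟩ := hc ν
  obtain ⟨F, j', p', w₂, hS₂, m', hc₂, hjm', hmq'⟩ := T.cls_pull hS c
  rw [hSe] at hc₂
  dsimp only at j' p' w₂ hS₂ m' hc₂ hjm' hmq'
  obtain ⟨n, hn⟩ := T.exists_extension hS₂ i (by rw [hc₂]; exact hν)
  dsimp only at n hn
  have : Epi p' := hS₂.epi_g
  have hz : j' ≫ (n ≫ m - m') = 0 := by
    rw [Preadditive.comp_sub, reassoc_of% hn, him, hjm', sub_self]
  let l : Y ⟶ W := hS₂.exact.desc (n ≫ m - m') hz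
  have hl : p' ≫ l = n ≫ m - m' := hS₂.exact.g_desc _ hz
  have hz' : j' ≫ n ≫ p = 0 := by rw [reassoc_of% hn, w₁]
  let g : Y ⟶ M := hS₂.exact.desc (n ≫ p) hz'
  have hg : p' ≫ g = n ≫ p := hS₂.exact.g_desc _ hz'
  have hlq : l ≫ q = g ≫ biprod.inl - c := by
    rw [← cancel_epi p', reassoc_of% hl, Preadditive.sub_comp, Preadditive.comp_sub,
      reassoc_of% hg, Category.assoc, hmq, hmq']
  have hq : T.pull q X e = 0 := by rw [← hSe]; exact T.pull_g_cls hS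
  refine ⟨g, ?_⟩
  rw [← he, ← pull_comp_apply, ← sub_eq_zero, ← pull_sub_apply, ← hlq, pull_comp_apply, hq,
    map_zero]

/-- Let `μ ∈ Ext(Y,M)` and suppose `Ext(Y,X)` is finite-dimensional.  Then `μ` has a conflation
`M → E → Y` such that every class in the kernel of `Ext(Y,X) → Ext(E,X)` is a pushout
of `μ`. -/
lemma exists_deflation_of_class {Y M : C} (X : C) [FiniteDimensional k (T.ext Y X)]
    (μ : T.ext Y M) : ∃ (E : C) (p : E ⟶ Y), T.pull p M μ = 0 ∧
      ∀ ν : T.ext Y X, T.pull p X ν = 0 → ∃ g : M ⟶ X, T.push Y g μ = ν := by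
  have : HasFiniteBiproducts C := HasFiniteBiproducts.of_hasFiniteProducts
  let b := Module.finBasis k (T.ext Y X)
  let N := M ⊞ ⨁ fun _ : Fin (Module.finrank k (T.ext Y X)) => X
  let e : T.ext Y N := T.push Y biprod.inl μ +
    ∑ l, T.push Y (biproduct.ι (fun _ => X) l ≫ biprod.inr) (b l)
  have he : T.push Y biprod.fst e = μ := by
    simp only [e, map_add, map_sum, ← push_comp_apply, Category.assoc, biprod.inl_fst,
      biprod.inr_fst, comp_zero, push_zero_apply, push_id_apply, Finset.sum_const_zero, add_zero]
  have hc (ν : T.ext Y X) : ∃ c : N ⟶ X, T.push Y c e = ν := by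
    refine ⟨biprod.snd ≫ biproduct.desc (fun l => b.repr ν l • 𝟙 X), ?_⟩
    simp only [e, map_add, map_sum, ← push_comp_apply, Category.assoc, biprod.inl_snd_assoc,
      biprod.inr_snd_assoc, zero_comp, push_zero_apply, zero_add, biproduct.ι_desc,
      push_smul_apply, push_id_apply]
    exact b.sum_repr ν
  obtain ⟨W, q, j, w, hS, hSe⟩ := T.cls_surjective Y N e
  obtain ⟨E, p, i, w₁, hS₁, m, hc₁, hqm, hmi⟩ := T.cls_push hS biprod.fst
  rw [hSe, he] at hc₁
  dsimp only at i p w₁ hS₁ m hc₁ hqm hmi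
  refine ⟨E, i, by rw [← hc₁]; exact T.pull_g_cls hS₁, fun ν hν => ?_⟩
  obtain ⟨c, rfl⟩ := hc ν
  obtain ⟨F, p', j', w₂, hS₂, m', hc₂, hqm', hmj'⟩ := T.cls_push hS c
  rw [hSe] at hc₂
  dsimp only at j' p' w₂ hS₂ m' hc₂ hqm' hmj'
  obtain ⟨n, hn⟩ := T.exists_lift hS₂ i (by rw [hc₂]; exact hν)
  dsimp only at n hn
  have : Mono p' := hS₂.mono_f
  have hz : (m ≫ n - m') ≫ j' = 0 := by
    rw [Preadditive.sub_comp, Category.assoc, hn, hmi, hmj', sub_self]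
  let l : W ⟶ X := hS₂.exact.lift (m ≫ n - m') hz
  have hl : l ≫ p' = m ≫ n - m' := hS₂.exact.lift_f _ hz
  have hz' : (p ≫ n) ≫ j' = 0 := by rw [Category.assoc, hn, w₁]
  let g : M ⟶ X := hS₂.exact.lift (p ≫ n) hz'
  have hg : g ≫ p' = p ≫ n := hS₂.exact.lift_f _ hz'
  have hlq : q ≫ l = biprod.fst ≫ g - c := by
    rw [← cancel_mono p', Category.assoc, hl, Preadditive.sub_comp, Preadditive.comp_sub,
      Category.assoc, hg, reassoc_of% hqm, hqm']
  have hq : T.push Y q e = 0 := by rw [← hSe]; exact T.push_f_cls hS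
  refine ⟨g, ?_⟩
  rw [← he, ← push_comp_apply, ← sub_eq_zero, ← push_sub_apply, ← hlq, push_comp_apply, hq,
    map_zero]

end YonedaExt

/-- A pairing into the dual of a finite-dimensional
space that separates points is surjective. -/
lemma surjective_of_separating {V U : Type*} [AddCommGroup V] [Module k V] [AddCommGroup U]
    [Module k U] [FiniteDimensional k V] (B : U →ₗ[k] Module.Dual k V)
    (h : ∀ v, (∀ u, B u v = 0) → v = 0) : Function.Surjective B := by
  refine LinearMap.flip_injective_iff₂.1 ?_
  rw [← LinearMap.ker_eq_bot, LinearMap.ker_eq_bot']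
  exact fun v hv => h v fun u => LinearMap.congr_fun hv u

lemma exists_comp_eq_of_ker_le {V U : Type*} [AddCommGroup V] [Module k V] [AddCommGroup U]
    [Module k U] {f : V →ₗ[k] U} {α : Module.Dual k V}
    (h : LinearMap.ker f ≤ LinearMap.ker α) : ∃ δ : Module.Dual k U, δ ∘ₗ f = α := by
  have : α ∈ LinearMap.range f.dualMap := by
    rw [LinearMap.range_dualMap_eq_dualAnnihilator_ker]
    exact (Submodule.mem_dualAnnihilator α).2 fun v hv => h hv
  exact this

/-- If `α ∈ D Ext(Y,X)` induces an isomorphism `Hom̄(-,X) ≅ D Ext(Y,-)`, then it induces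
a surjection `Hom(Y,M) → D Ext(M,X)` whenever `Ext(M,X)` is finite-dimensional. -/
lemma exists_pull_of_perfect_push (T : YonedaExt k C) {X Y : C}
    (α : Module.Dual k (T.ext Y X))
    (hs : ∀ (M : C) (γ : Module.Dual k (T.ext Y M)), ∃ f : M ⟶ X, ∀ μ, α (T.push Y f μ) = γ μ)
    (hi : ∀ (M : C) (f : M ⟶ X), (∀ μ, α (T.push Y f μ) = 0) → f ∈ ITriv T M X)
    [FiniteDimensional k (T.ext Y X)] (M : C) [FiniteDimensional k (T.ext M X)]
    (γ : Module.Dual k (T.ext M X)) : ∃ g : Y ⟶ M, ∀ μ, α (T.pull g X μ) = γ μ := by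
  let B : (Y ⟶ M) →ₗ[k] Module.Dual k (T.ext M X) :=
    LinearMap.mk₂ k (fun g μ => α (T.pull g X μ))
      (fun g g' μ => by rw [T.pull_add_apply, map_add])
      (fun a g μ => by rw [T.pull_smul_apply, map_smul])
      (fun g μ μ' => by rw [map_add, map_add]) (fun a g μ => by rw [map_smul, map_smul])
  have hB : Function.Surjective B := by
    refine surjective_of_separating B fun μ hμ => ?_
    obtain ⟨E, i, hi₀, hker⟩ := T.exists_inflation_of_class Y μ
    have hle : LinearMap.ker (T.push Y i) ≤ LinearMap.ker α := by
      intro ν hν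
      obtain ⟨g, rfl⟩ := hker ν hν
      exact hμ g
    obtain ⟨δ, rfl⟩ := exists_comp_eq_of_ker_le hle
    obtain ⟨h, hh⟩ := hs E δ
    have hmem : i ≫ h - 𝟙 X ∈ ITriv T X X := hi X _ fun ν => by
      rw [T.push_sub_apply, T.push_comp_apply, T.push_id_apply, map_sub, hh]
      exact sub_self _
    have := LinearMap.congr_fun (mem_ITriv.1 hmem M) μ
    rw [T.push_sub_apply, T.push_comp_apply, hi₀, map_zero, T.push_id_apply, zero_sub] at this
    exact neg_eq_zero.1 this
  obtain ⟨g, hg⟩ := hB γ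
  exact ⟨g, LinearMap.congr_fun hg⟩

/-- If `α ∈ D Ext(Y,X)` induces an isomorphism `Hom̲(Y,-) ≅ D Ext(-,X)`, then it induces
a surjection `Hom(M,X) → D Ext(Y,M)` whenever `Ext(Y,M)` is finite-dimensional. -/
lemma exists_push_of_perfect_pull (T : YonedaExt k C) {X Y : C}
    (α : Module.Dual k (T.ext Y X))
    (hs : ∀ (M : C) (γ : Module.Dual k (T.ext M X)), ∃ g : Y ⟶ M, ∀ μ, α (T.pull g X μ) = γ μ)
    (hi : ∀ (M : C) (g : Y ⟶ M), (∀ μ, α (T.pull g X μ) = 0) → g ∈ PTriv T Y M)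
    [FiniteDimensional k (T.ext Y X)] (M : C) [FiniteDimensional k (T.ext Y M)]
    (γ : Module.Dual k (T.ext Y M)) : ∃ f : M ⟶ X, ∀ μ, α (T.push Y f μ) = γ μ := by
  let B : (M ⟶ X) →ₗ[k] Module.Dual k (T.ext Y M) :=
    LinearMap.mk₂ k (fun f μ => α (T.push Y f μ))
      (fun f f' μ => by rw [T.push_add_apply, map_add])
      (fun a f μ => by rw [T.push_smul_apply, map_smul])
      (fun f μ μ' => by rw [map_add, map_add]) (fun a f μ => by rw [map_smul, map_smul])
  have hB : Function.Surjective B := by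
    refine surjective_of_separating B fun μ hμ => ?_
    obtain ⟨E, p, hp₀, hker⟩ := T.exists_deflation_of_class X μ
    have hle : LinearMap.ker (T.pull p X) ≤ LinearMap.ker α := by
      intro ν hν
      obtain ⟨f, rfl⟩ := hker ν hν
      exact hμ f
    obtain ⟨δ, rfl⟩ := exists_comp_eq_of_ker_le hle
    obtain ⟨h, hh⟩ := hs E δ
    have hmem : h ≫ p - 𝟙 Y ∈ PTriv T Y Y := hi Y _ fun ν => by
      rw [T.pull_sub_apply, T.pull_comp_apply, T.pull_id_apply, map_sub, hh]
      exact sub_self _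
    have := LinearMap.congr_fun (mem_PTriv.1 hmem M) μ
    rw [T.pull_sub_apply, T.pull_comp_apply, hp₀, map_zero, T.pull_id_apply, zero_sub] at this
    exact neg_eq_zero.1 this
  obtain ⟨f, hf⟩ := hB γ
  exact ⟨f, LinearMap.congr_fun hf⟩

/-- If every linear form on every `Ext(Y,Z)` is induced by `α ∈ D Ext(Y,X)`, then
`Hom̲(Y,-) → D Ext(-,X)` is injective. -/
lemma mem_PTriv_of_forall_pull (T : YonedaExt k C) {X Y : C} (α : Module.Dual k (T.ext Y X))
    (hs : ∀ (M : C) (γ : Module.Dual k (T.ext Y M)), ∃ f : M ⟶ X, ∀ μ, α (T.push Y f μ) = γ μ)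
    {M : C} (g : Y ⟶ M) (hg : ∀ μ, α (T.pull g X μ) = 0) : g ∈ PTriv T Y M := by
  refine fun Z => LinearMap.ext fun ν => (Module.forall_dual_apply_eq_zero_iff k _).1 fun γ => ?_
  obtain ⟨f, hf⟩ := hs Z γ
  rw [← hf, T.push_pull_apply, hg]

/-- If every linear form on every `Ext(Z,X)` is induced by `α ∈ D Ext(Y,X)`, then
`Hom̄(-,X) → D Ext(Y,-)` is injective. -/
lemma mem_ITriv_of_forall_push (T : YonedaExt k C) {X Y : C} (α : Module.Dual k (T.ext Y X))
    (hs : ∀ (M : C) (γ : Module.Dual k (T.ext M X)), ∃ g : Y ⟶ M, ∀ μ, α (T.pull g X μ) = γ μ)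
    {M : C} (f : M ⟶ X) (hf : ∀ μ, α (T.push Y f μ) = 0) : f ∈ ITriv T M X := by
  refine fun Z => LinearMap.ext fun ν => (Module.forall_dual_apply_eq_zero_iff k _).1 fun γ => ?_
  obtain ⟨g, hg⟩ := hs Z γ
  rw [← hg, ← T.push_pull_apply, hf]

lemma MemCr.finiteDimensional_ext {T : YonedaExt k C}
    (homFinite : ∀ X Y : C, FiniteDimensional k (X ⟶ Y)) {Y : C} (hY : MemCr T Y) (M : C) :
    FiniteDimensional k (T.ext Y M) := by
  obtain ⟨Yt, e, -⟩ := hY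
  have := homFinite M Yt
  exact (Module.finite_dual_iff k).1 (Module.Finite.equiv (e M))

lemma MemCl.finiteDimensional_ext {T : YonedaExt k C}
    (homFinite : ∀ X Y : C, FiniteDimensional k (X ⟶ Y)) {X : C} (hX : MemCl T X) (M : C) :
    FiniteDimensional k (T.ext M X) := by
  obtain ⟨Xt, e, -⟩ := hX
  have := homFinite Xt M
  exact (Module.finite_dual_iff k).1 (Module.Finite.equiv (e M))

namespace TranslationData

variable {T : YonedaExt k C} (D : TranslationData T)

lemma phi_apply {Y : C} (hY : MemCr T Y) {M : C} (f : M ⟶ D.tau Y hY) (μ : T.ext Y M) :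
    D.phi Y hY M (Submodule.Quotient.mk f) μ =
      D.phi Y hY _ (Submodule.Quotient.mk (𝟙 _)) (T.push Y f μ) := by
  rw [← D.phi_natural, Category.comp_id]

lemma psi_apply {X : C} (hX : MemCl T X) {M : C} (g : D.taum X hX ⟶ M) (μ : T.ext M X) :
    D.psi X hX M (Submodule.Quotient.mk g) μ =
      D.psi X hX _ (Submodule.Quotient.mk (𝟙 _)) (T.pull g X μ) := by
  rw [← D.psi_natural, Category.id_comp]

lemma exists_phi {Y : C} (hY : MemCr T Y) {M : C} (γ : Module.Dual k (T.ext Y M)) :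
    ∃ f : M ⟶ D.tau Y hY, D.phi Y hY M (Submodule.Quotient.mk f) = γ := by
  obtain ⟨f, hf⟩ := Submodule.Quotient.mk_surjective _ ((D.phi Y hY M).symm γ)
  exact ⟨f, by rw [hf, LinearEquiv.apply_symm_apply]⟩

lemma exists_psi {X : C} (hX : MemCl T X) {M : C} (γ : Module.Dual k (T.ext M X)) :
    ∃ g : D.taum X hX ⟶ M, D.psi X hX M (Submodule.Quotient.mk g) = γ := by
  obtain ⟨g, hg⟩ := Submodule.Quotient.mk_surjective _ ((D.psi X hX M).symm γ)
  exact ⟨g, by rw [hg, LinearEquiv.apply_symm_apply]⟩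

/-- `ε̲_Y` is invertible in the projectively stable category. -/
lemma exists_inverse_epsClass (homFinite : ∀ X Y : C, FiniteDimensional k (X ⟶ Y))
    (Y : C) (hY : MemCr T Y) (hτY : MemCl T (D.tau Y hY)) :
    ∃ (e : D.taum (D.tau Y hY) hτY ⟶ Y) (e' : Y ⟶ D.taum (D.tau Y hY) hτY),
      Submodule.Quotient.mk e = epsClass D Y hY hτY ∧
      (Submodule.Quotient.mk (e ≫ e') : HomUnder T _ _) = Submodule.Quotient.mk (𝟙 _) ∧
      (Submodule.Quotient.mk (e' ≫ e) : HomUnder T Y Y) = Submodule.Quotient.mk (𝟙 Y) := by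
  have hfd := fun M => hτY.finiteDimensional_ext homFinite M
  let α := D.phi Y hY _ (Submodule.Quotient.mk (𝟙 (D.tau Y hY)))
  have hs (M : C) (γ : Module.Dual k (T.ext Y M)) :
      ∃ f : M ⟶ D.tau Y hY, ∀ μ, α (T.push Y f μ) = γ μ := by
    obtain ⟨f, rfl⟩ := D.exists_phi hY γ
    exact ⟨f, fun μ => (D.phi_apply hY f μ).symm⟩
  have hi (M : C) (f : M ⟶ D.tau Y hY) (hf : ∀ μ, α (T.push Y f μ) = 0) :
      f ∈ ITriv T M _ := by
    rw [← Submodule.Quotient.mk_eq_zero, ← (D.phi Y hY M).map_eq_zero_iff]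
    exact LinearMap.ext fun μ => (D.phi_apply hY f μ).trans (hf μ)
  obtain ⟨e, he⟩ := Submodule.Quotient.mk_surjective _ (epsClass D Y hY hτY)
  have hα : D.psi _ hτY Y (Submodule.Quotient.mk e) = α := by
    rw [he]; exact LinearEquiv.apply_symm_apply _ _
  obtain ⟨e', he'⟩ := exists_pull_of_perfect_push T α hs hi _
    (D.psi _ hτY _ (Submodule.Quotient.mk (𝟙 _)))
  refine ⟨e, e', he, (D.psi _ hτY _).injective (LinearMap.ext fun μ => ?_), ?_⟩
  · rw [D.psi_natural, hα, he']
  · refine (Submodule.Quotient.eq _).2 (mem_PTriv_of_forall_pull T α hs _ fun μ => ?_)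
    rw [T.pull_sub_apply, T.pull_comp_apply, T.pull_id_apply, map_sub, he', ← D.psi_apply, hα,
      sub_self]

/-- `η̄_X` is invertible in the injectively stable category. -/
lemma exists_inverse_etaClass (homFinite : ∀ X Y : C, FiniteDimensional k (X ⟶ Y))
    (X : C) (hX : MemCl T X) (hτX : MemCr T (D.taum X hX)) :
    ∃ (n : X ⟶ D.tau (D.taum X hX) hτX) (n' : D.tau (D.taum X hX) hτX ⟶ X),
      Submodule.Quotient.mk n = etaClass D X hX hτX ∧
      (Submodule.Quotient.mk (n ≫ n') : HomBar T X X) = Submodule.Quotient.mk (𝟙 X) ∧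
      (Submodule.Quotient.mk (n' ≫ n) : HomBar T _ _) = Submodule.Quotient.mk (𝟙 _) := by
  have hfd := fun M => hτX.finiteDimensional_ext homFinite M
  let α := D.psi X hX _ (Submodule.Quotient.mk (𝟙 (D.taum X hX)))
  have hs (M : C) (γ : Module.Dual k (T.ext M X)) :
      ∃ g : D.taum X hX ⟶ M, ∀ μ, α (T.pull g X μ) = γ μ := by
    obtain ⟨g, rfl⟩ := D.exists_psi hX γ
    exact ⟨g, fun μ => (D.psi_apply hX g μ).symm⟩
  have hi (M : C) (g : D.taum X hX ⟶ M) (hg : ∀ μ, α (T.pull g X μ) = 0) :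
      g ∈ PTriv T _ M := by
    rw [← Submodule.Quotient.mk_eq_zero, ← (D.psi X hX M).map_eq_zero_iff]
    exact LinearMap.ext fun μ => (D.psi_apply hX g μ).trans (hg μ)
  obtain ⟨n, hn⟩ := Submodule.Quotient.mk_surjective _ (etaClass D X hX hτX)
  have hα : D.phi _ hτX X (Submodule.Quotient.mk n) = α := by
    rw [hn]; exact LinearEquiv.apply_symm_apply _ _
  obtain ⟨n', hn'⟩ := exists_push_of_perfect_pull T α hs hi _
    (D.phi _ hτX _ (Submodule.Quotient.mk (𝟙 _)))
  refine ⟨n, n', hn, ?_, (D.phi _ hτX _).injective (LinearMap.ext fun μ => ?_)⟩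
  · refine (Submodule.Quotient.eq _).2 (mem_ITriv_of_forall_push T α hs _ fun μ => ?_)
    rw [T.push_sub_apply, T.push_comp_apply, T.push_id_apply, map_sub, hn', ← D.phi_apply, hα,
      sub_self]
  · rw [D.phi_natural, hα, hn']

end TranslationData


/-- **Proposition 3.4**.  The natural transformations `ε̲ : τ⁻τ → Id` and `η̄ : Id → ττ⁻`
are both isomorphisms; hence the generalized Auslander-Reiten translation functors
`τ : C̲_r → C̄_l` and `τ⁻ : C̄_l → C̲_r` are mutually quasi-inverse equivalences.
(Each `ε̲_Y` admits a representative `e` which is invertible in the projectively stable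
category, and dually each `η̄_X` admits a representative `n` invertible in the injectively
stable category.) -/
theorem prop_quasi_inverse
    (homFinite : ∀ X Y : C, FiniteDimensional k (X ⟶ Y))
    (T : YonedaExt k C) (D : TranslationData T) :
    (∀ (Y : C) (hY : MemCr T Y) (hτY : MemCl T (D.tau Y hY)),
      ∃ (e : D.taum (D.tau Y hY) hτY ⟶ Y) (e' : Y ⟶ D.taum (D.tau Y hY) hτY),
        Submodule.Quotient.mk e = epsClass D Y hY hτY ∧
        (Submodule.Quotient.mk (e ≫ e') :
            HomUnder T (D.taum (D.tau Y hY) hτY) (D.taum (D.tau Y hY) hτY)) =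
          Submodule.Quotient.mk (𝟙 (D.taum (D.tau Y hY) hτY)) ∧
        (Submodule.Quotient.mk (e' ≫ e) : HomUnder T Y Y) =
          Submodule.Quotient.mk (𝟙 Y)) ∧
    (∀ (X : C) (hX : MemCl T X) (hτX : MemCr T (D.taum X hX)),
      ∃ (n : X ⟶ D.tau (D.taum X hX) hτX) (n' : D.tau (D.taum X hX) hτX ⟶ X),
        Submodule.Quotient.mk n = etaClass D X hX hτX ∧
        (Submodule.Quotient.mk (n ≫ n') : HomBar T X X) =
          Submodule.Quotient.mk (𝟙 X) ∧
        (Submodule.Quotient.mk (n' ≫ n) :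
            HomBar T (D.tau (D.taum X hX) hτX) (D.tau (D.taum X hX) hτX)) =
          Submodule.Quotient.mk (𝟙 (D.tau (D.taum X hX) hτX))) := by
  exact ⟨D.exists_inverse_epsClass homFinite, D.exists_inverse_etaClass homFinite⟩

end GenAR
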